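/- Let f : ℝ → ℝ be twice continuously differentiable. For 0 ≤ t < τ and a, b ∈ ℝ define H(t,a;τ,b) := (2π(τ−t))^{-1/2} · exp( (1/2)∫_t^τ f′(u)² du − f′(τ)·b + f′(t)·a ) · [ exp( −(b − a − ∫_t^τ f′(u) du)²/(2(τ−t)) ) − exp( −(b + a − ∫_t^τ f′(u) du)²/(2(τ−t)) ) ]. Fix t ≥ 0 and a ∈ ℝ. Then the function (τ,b) ↦ H(t,a;τ,b) satisfies the forward Schrödinger equation ∂_τ H(t,a;τ,b) = (1/2) ∂²_{bb} H(t,a;τ,b) − b·f″(τ)·H(t,a;τ,b) for all τ > t and b ∈ ℝ. -/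

import Mathlib

/-- The drifted Gaussian kernel started at time `t` from the point `c`, with accumulated drift `F`,
tilted by the factor `exp (A τ - g τ * b + k)`. -/
noncomputable def tiltedKernel (A F g : ℝ → ℝ) (k t c τ b : ℝ) : ℝ :=
  (2 * Real.pi * (τ - t)) ^ (-(1:ℝ)/2) * Real.exp (A τ - g τ * b + k) *
    Real.exp (-(b - c - F τ) ^ 2 / (2 * (τ - t)))

theorem hasDerivAt_tiltedKernel_space (A F g : ℝ → ℝ) (k c : ℝ) {t τ : ℝ} (h : t < τ) (b : ℝ) :
    HasDerivAt (fun b' => tiltedKernel A F g k t c τ b')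
      ((-g τ - (b - c - F τ) / (τ - t)) * tiltedKernel A F g k t c τ b) b := by
  have hs : τ - t ≠ 0 := (sub_pos.2 h).ne'
  have h1 : HasDerivAt (fun b' : ℝ => A τ - g τ * b' + k) (-(g τ * 1)) b :=
    (((hasDerivAt_id' b).const_mul (g τ)).const_sub (A τ)).add_const k
  have h2 : HasDerivAt (fun b' : ℝ => -(b' - c - F τ) ^ 2 / (2 * (τ - t))) _ b :=
    (((((hasDerivAt_id' b).sub_const c).sub_const (F τ)).fun_pow 2).fun_neg).div_const _
  refine ((h1.exp.const_mul ((2 * Real.pi * (τ - t)) ^ (-(1:ℝ)/2))).fun_mul h2.exp).congr_deriv ?_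
  unfold tiltedKernel
  field_simp
  push_cast
  ring

theorem hasDerivAt_deriv_tiltedKernel_space (A F g : ℝ → ℝ) (k c : ℝ) {t τ : ℝ} (h : t < τ)
    (b : ℝ) :
    HasDerivAt (deriv fun b' => tiltedKernel A F g k t c τ b')
      (((-g τ - (b - c - F τ) / (τ - t)) ^ 2 - 1 / (τ - t)) * tiltedKernel A F g k t c τ b) b := by
  have hd : (deriv fun b' => tiltedKernel A F g k t c τ b') =
      fun b' => (-g τ - (b' - c - F τ) / (τ - t)) * tiltedKernel A F g k t c τ b' :=
    funext fun b' => (hasDerivAt_tiltedKernel_space A F g k c h b').deriv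
  rw [hd]
  have h1 : HasDerivAt (fun b' : ℝ => -g τ - (b' - c - F τ) / (τ - t)) _ b :=
    ((((hasDerivAt_id' b).sub_const c).sub_const (F τ)).div_const (τ - t)).const_sub (-g τ)
  refine (h1.fun_mul (hasDerivAt_tiltedKernel_space A F g k c h b)).congr_deriv ?_
  ring

theorem hasDerivAt_tiltedKernel_time {A F g : ℝ → ℝ} {A' F' g' : ℝ} (k c : ℝ) {t τ : ℝ}
    (h : t < τ) (b : ℝ) (hA : HasDerivAt A A' τ) (hF : HasDerivAt F F' τ)
    (hg : HasDerivAt g g' τ) :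
    HasDerivAt (fun τ' => tiltedKernel A F g k t c τ' b)
      ((-1 / (2 * (τ - t)) + A' - g' * b + (b - c - F τ) * F' / (τ - t)
        + (b - c - F τ) ^ 2 / (2 * (τ - t) ^ 2)) * tiltedKernel A F g k t c τ b) τ := by
  have hs : 0 < τ - t := sub_pos.2 h
  have hp : 0 < 2 * Real.pi * (τ - t) := by positivity
  have h0 : HasDerivAt (fun τ' : ℝ => τ' - t) 1 τ := (hasDerivAt_id' τ).sub_const t
  have h1 := (h0.const_mul (2 * Real.pi)).rpow_const (p := -(1:ℝ)/2) (Or.inl hp.ne')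
  have h2 : HasDerivAt (fun τ' => A τ' - g τ' * b + k) (A' - g' * b) τ :=
    (hA.fun_sub (hg.mul_const b)).add_const k
  have h3 : HasDerivAt (fun τ' => -(b - c - F τ') ^ 2 / (2 * (τ' - t))) _ τ :=
    ((hF.const_sub (b - c)).fun_pow 2).fun_neg.fun_div (h0.const_mul 2) (by positivity)
  refine ((h1.fun_mul h2.exp).fun_mul h3.exp).congr_deriv ?_
  unfold tiltedKernel
  rw [Real.rpow_sub_one hp.ne']
  have hpi := Real.pi_ne_zero
  have hs' := hs.ne'
  generalize (2 * Real.pi * (τ - t)) ^ (-(1:ℝ)/2) = P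
  generalize Real.exp (A τ - g τ * b + k) = X
  generalize Real.exp (-(b - c - F τ) ^ 2 / (2 * (τ - t))) = Y
  push_cast
  field_simp
  ring


/-- With `H(t,a;τ,b)` as in the paper, for fixed `t ≥ 0` and `a ∈ ℝ`, the
function `(τ,b) ↦ H(t,a;τ,b)` satisfies the forward Schrödinger equation
`∂_τ H = (1/2)∂²_{bb}H − b·f″(τ)·H` for all `τ > t` and `b ∈ ℝ`. -/
theorem stmt_10 (f : ℝ → ℝ) (hf : ContDiff ℝ 2 f)
    (H : ℝ → ℝ → ℝ → ℝ → ℝ)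
    (hH : ∀ t a τ b : ℝ, 0 ≤ t → t < τ →
      H t a τ b = (2 * Real.pi * (τ - t)) ^ (-(1:ℝ)/2) *
        Real.exp ((1/2) * (∫ u in t..τ, (deriv f u) ^ 2) - deriv f τ * b + deriv f t * a) *
        (Real.exp (-(b - a - ∫ u in t..τ, deriv f u) ^ 2 / (2 * (τ - t)))
          - Real.exp (-(b + a - ∫ u in t..τ, deriv f u) ^ 2 / (2 * (τ - t)))))
    (t : ℝ) (ht : 0 ≤ t) (a : ℝ) :
    ∀ τ : ℝ, t < τ → ∀ b : ℝ,
      deriv (fun τ' => H t a τ' b) τ =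
        (1/2) * deriv (deriv (fun b' => H t a τ b')) b
          - b * deriv (deriv f) τ * H t a τ b := by
  intro τ hτ b
  set A : ℝ → ℝ := fun s => (1/2) * ∫ u in t..s, (deriv f u) ^ 2 with hAdef
  set F : ℝ → ℝ := fun s => ∫ u in t..s, deriv f u with hFdef
  set k : ℝ := deriv f t * a with hk
  have hHK : ∀ s, t < s → ∀ b', H t a s b' =
      tiltedKernel A F (deriv f) k t a s b' - tiltedKernel A F (deriv f) k t (-a) s b' := by
    intro s hs b'
    rw [hH t a s b' ht hs]
    simp only [tiltedKernel, hAdef, hFdef, hk, sub_neg_eq_add]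
    ring
  have hc : Continuous (deriv f) := hf.continuous_deriv (by norm_num)
  have hg : HasDerivAt (deriv f) (deriv (deriv f) τ) τ :=
    ((hf.iterate_deriv' 1 1).differentiable (by norm_num) τ).hasDerivAt
  have hF : HasDerivAt F (deriv f τ) τ := (hc.integral_hasStrictDerivAt t τ).hasDerivAt
  have hA : HasDerivAt A ((1/2) * (deriv f τ) ^ 2) τ :=
    ((hc.pow 2).integral_hasStrictDerivAt t τ).hasDerivAt.const_mul (1/2)
  have htime : deriv (fun τ' => H t a τ' b) τ = _ :=
    (((hasDerivAt_tiltedKernel_time k a hτ b hA hF hg).fun_sub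
      (hasDerivAt_tiltedKernel_time k (-a) hτ b hA hF hg)).congr_of_eventuallyEq
      ((lt_mem_nhds hτ).mono fun s hs => hHK s hs b)).deriv
  have hfirst : deriv (fun b' => H t a τ b') =
      fun b' => deriv (fun x => tiltedKernel A F (deriv f) k t a τ x) b'
        - deriv (fun x => tiltedKernel A F (deriv f) k t (-a) τ x) b' := by
    funext b'
    simp only [hHK τ hτ]
    exact deriv_fun_sub (hasDerivAt_tiltedKernel_space A F _ k a hτ b').differentiableAt
      (hasDerivAt_tiltedKernel_space A F _ k (-a) hτ b').differentiableAt
  rw [htime, hfirst, ((hasDerivAt_deriv_tiltedKernel_space A F _ k a hτ b).fun_sub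
    (hasDerivAt_deriv_tiltedKernel_space A F _ k (-a) hτ b)).deriv, hHK τ hτ b]
  have hs : τ - t ≠ 0 := (sub_pos.2 hτ).ne'
  field_simp
  ring
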